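/- arXiv:1306.3187 — 4 statements merged into one kernel-verified Lean document; each statement's English description precedes it below -/
import Mathlib

section
/- Let V be a finite-dimensional real inner product space and K a compact topological group acting continuously and irreducibly on V by orthogonal linear transformations (the only K-invariant subspaces are {0} and V). Let x₀ ∈ V, x₀ ≠ 0, and C = Conv(K·x₀). If E ⊆ C is an ellipsoid (the image of the closed unit ball under an invertible affine map) whose Lebesgue volume is maximal among all ellipsoids contained in C, then E is a closed metric ball centered at 0. -/
open MeasureTheory

/-- An ellipsoid in a real normed space: the image of the closed unit ball under an
invertible affine transformation. -/
def IsEllipsoid {V : Type*} [NormedAddCommGroup V] [NormedSpace ℝ V] (E : Set V) : Prop :=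
  ∃ f : V ≃ᵃ[ℝ] V, E = f '' Metric.closedBall (0 : V) 1

open scoped InnerProductSpace

section

variable {V : Type*} [NormedAddCommGroup V] [InnerProductSpace ℝ V] [FiniteDimensional ℝ V]

/-- A volume-preserving linear map `Q` that is not orthogonal admits an inverse polar factor `P`
for which `Q ∘ P` is isometric and the midpoint of `1` and `P` strictly increases volume. -/
theorem norm_map_or_exists_one_lt_abs_det_midpoint (Q : V →ₗ[ℝ] V) (hQ : |LinearMap.det Q| = 1) :
    (∀ x, ‖Q x‖ = ‖x‖) ∨ ∃ P : V →ₗ[ℝ] V, (∀ x, ‖Q (P x)‖ = ‖x‖) ∧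
      1 < |LinearMap.det ((1 / 2 : ℝ) • (LinearMap.id + P))| := by
  have hdet : LinearMap.det Q ≠ 0 := fun h => by simp [h] at hQ
  have hT : (LinearMap.adjoint Q ∘ₗ Q).IsSymmetric := fun x y => by
    simp [LinearMap.adjoint_inner_left, LinearMap.adjoint_inner_right]
  set e := hT.eigenvectorBasis rfl with he
  set l := hT.eigenvalues rfl with hl
  have hinner (i j) : ⟪Q (e i), Q (e j)⟫_ℝ = l i * if i = j then 1 else 0 := by
    rw [← LinearMap.adjoint_inner_left]
    have := hT.apply_eigenvectorBasis rfl i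
    rw [LinearMap.comp_apply] at this
    rw [he, this, inner_smul_left, orthonormal_iff_ite.mp (hT.eigenvectorBasis rfl).orthonormal]
    simp [hl]
  have hinj : Function.Injective Q := (LinearEquiv.ofIsUnitDet
    (v := e.toBasis) (v' := e.toBasis) (f := Q)
    (by rw [LinearMap.det_toMatrix]; exact hdet.isUnit)).injective
  have hpos (i) : 0 < l i := by
    have h := hinner i i
    rw [if_pos rfl, mul_one, real_inner_self_eq_norm_sq] at h
    rw [← h]
    have : Q (e i) ≠ 0 := fun h0 => e.orthonormal.ne_zero i (hinj (by rw [h0, map_zero]))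
    positivity
  have hprod : ∏ i, l i = 1 := by
    have h := hT.det_eq_prod_eigenvalues rfl
    rw [← LinearMap.normDet_sq, LinearMap.normDet_eq_abs_det, hQ] at h
    simpa using h.symm
  by_cases hone : ∀ i, l i = 1
  · left
    have ho : Orthonormal ℝ (Q ∘ e.toBasis) := by
      rw [orthonormal_iff_ite]
      intro i j
      simp [hinner, hone]
    exact (Q.isometryOfOrthonormal (v := e.toBasis) (by simp) ho).norm_map
  · right
    push Not at hone
    obtain ⟨i₀, hi₀⟩ := hone
    set m : Fin (Module.finrank ℝ V) → ℝ := fun i => (√(l i))⁻¹ with hm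
    have hmpos (i) : 0 < m i := inv_pos.2 (Real.sqrt_pos.2 (hpos i))
    have hml (i) : m i * m i * l i = 1 := by
      have := Real.mul_self_sqrt (hpos i).le
      have h2 := Real.sqrt_pos.2 (hpos i)
      simp only [hm]
      field_simp
      nlinarith
    have hmprod : ∏ i, m i = 1 := by
      have h : (∏ i, m i) * (∏ i, m i) * ∏ i, l i = 1 := by
        rw [← Finset.prod_mul_distrib, ← Finset.prod_mul_distrib]
        exact Finset.prod_eq_one fun i _ => hml i
      have h2 : 0 < ∏ i, m i := Finset.prod_pos fun i _ => hmpos i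
      rw [hprod] at h
      nlinarith
    refine ⟨Matrix.toLin e.toBasis e.toBasis (Matrix.diagonal m), ?_, ?_⟩
    · have ho : Orthonormal ℝ
          ((Q ∘ₗ Matrix.toLin e.toBasis e.toBasis (Matrix.diagonal m)) ∘ e.toBasis) := by
        rw [orthonormal_iff_ite]
        intro i j
        rw [Function.comp_apply, Function.comp_apply, LinearMap.comp_apply, LinearMap.comp_apply,
          Matrix.toLin_self, Matrix.toLin_self]
        simp only [Matrix.diagonal_apply, ite_smul, zero_smul, Finset.sum_ite_eq', Finset.mem_univ,
          if_true, OrthonormalBasis.coe_toBasis, map_smul, inner_smul_left, inner_smul_right,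
          hinner, conj_trivial]
        split_ifs with h
        · subst h
          rw [mul_one, ← mul_assoc, hml]
        · simp
      exact (LinearMap.isometryOfOrthonormal _ (v := e.toBasis)
        (by simp) ho).norm_map
    · have hmid : (1 / 2 : ℝ) • (LinearMap.id + Matrix.toLin e.toBasis e.toBasis
          (Matrix.diagonal m)) = Matrix.toLin e.toBasis e.toBasis
          (Matrix.diagonal fun i => (1 + m i) / 2) := by
        refine e.toBasis.ext fun i => ?_
        rw [LinearMap.smul_apply, LinearMap.add_apply, Matrix.toLin_self, Matrix.toLin_self]
        simp only [Matrix.diagonal_apply, ite_smul, zero_smul, Finset.sum_ite_eq', Finset.mem_univ,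
          if_true, LinearMap.id_apply]
        module
      rw [hmid, LinearMap.det_toLin, Matrix.det_diagonal, ← one_lt_sq_iff_one_lt_abs,
        ← Finset.prod_pow]
      have hne : m i₀ ≠ 1 := fun h => hi₀ (by simpa [h] using hml i₀)
      calc (1 : ℝ) = ∏ i, m i := hmprod.symm
        _ < _ := Finset.prod_lt_prod (fun i _ => hmpos i)
          (fun i _ => by nlinarith [sq_nonneg (m i - 1)])
          ⟨i₀, Finset.mem_univ _, by nlinarith [sq_pos_of_ne_zero (sub_ne_zero.2 hne)]⟩

variable {K : Type*} [Group K] [MulAction K V]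

/-- A quadratic form `‖B x‖²` invariant under an irreducible orthogonal action is a multiple of
the squared norm. -/
theorem exists_norm_sq_eq_mul_norm_sq_of_invariant [Nontrivial V]
    (hlin : ∀ k : K, IsLinearMap ℝ (fun v : V => k • v))
    (hiso : ∀ (k : K) (v : V), ‖k • v‖ = ‖v‖)
    (hirr : ∀ W : Submodule ℝ V, (∀ (k : K), ∀ w ∈ W, k • w ∈ W) → W = ⊥ ∨ W = ⊤)
    (B : V →ₗ[ℝ] V) (hB : ∀ (k : K) x, ‖B (k • x)‖ = ‖B x‖) :
    ∃ a : ℝ, ∀ x, ‖B x‖ ^ 2 = a * ‖x‖ ^ 2 := by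
  have hT : (LinearMap.adjoint B ∘ₗ B).IsSymmetric := fun x y => by
    simp [LinearMap.adjoint_inner_left, LinearMap.adjoint_inner_right]
  have hinner (k : K) (x y : V) : ⟪k • x, k • y⟫_ℝ = ⟪x, y⟫_ℝ := by
    rw [real_inner_eq_norm_add_mul_self_sub_norm_mul_self_sub_norm_mul_self_div_two,
      real_inner_eq_norm_add_mul_self_sub_norm_mul_self_sub_norm_mul_self_div_two,
      ← (hlin k).map_add]
    simp only [hiso]
  have hinnerB (k : K) (x y : V) : ⟪B (k • x), B (k • y)⟫_ℝ = ⟪B x, B y⟫_ℝ := by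
    rw [real_inner_eq_norm_add_mul_self_sub_norm_mul_self_sub_norm_mul_self_div_two,
      real_inner_eq_norm_add_mul_self_sub_norm_mul_self_sub_norm_mul_self_div_two,
      ← map_add, ← map_add, ← (hlin k).map_add]
    simp only [hB]
  have hcomm (k : K) (x : V) :
      (LinearMap.adjoint B) (B (k • x)) = k • (LinearMap.adjoint B) (B x) := by
    refine ext_inner_right ℝ fun y => ?_
    have hy : y = k • k⁻¹ • y := by simp
    rw [LinearMap.adjoint_inner_left, hy, hinnerB, hinner, LinearMap.adjoint_inner_left]
  let i : Fin (Module.finrank ℝ V) := ⟨0, Module.finrank_pos⟩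
  have hv := hT.hasEigenvector_eigenvectorBasis rfl i
  set a := hT.eigenvalues rfl i
  have htop : Module.End.eigenspace (LinearMap.adjoint B ∘ₗ B) a = ⊤ := by
    refine (hirr _ fun k w hw => ?_).resolve_left fun h => hv.2 ?_
    · rw [Module.End.mem_eigenspace_iff, LinearMap.comp_apply] at hw ⊢
      rw [hcomm, hw, (hlin k).map_smul]
    · simpa [h] using hv.1
  refine ⟨a, fun x => ?_⟩
  have hx : x ∈ Module.End.eigenspace (LinearMap.adjoint B ∘ₗ B) a := htop ▸ Submodule.mem_top
  rw [Module.End.mem_eigenspace_iff, LinearMap.comp_apply] at hx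
  rw [← real_inner_self_eq_norm_sq, ← LinearMap.adjoint_inner_left, hx, inner_smul_left,
    real_inner_self_eq_norm_sq]
  simp

/-- If an affine image of the unit ball has maximal volume among the ellipsoids in `C`, then
composing its linear part with a linear map of larger determinant leaves `C`. -/
theorem abs_det_le_one_of_volume_maximal [MeasurableSpace V] [BorelSpace V]
    {C : Set V} (f : V ≃ᵃ[ℝ] V)
    (hmax : ∀ E' : Set V, IsEllipsoid E' → E' ⊆ C →
      volume E' ≤ volume (f '' Metric.closedBall (0 : V) 1))
    (L : V →ₗ[ℝ] V) (m : V) (hL : ∀ b, ‖b‖ ≤ 1 → m + f.linear (L b) ∈ C) :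
    |LinearMap.det L| ≤ 1 := by
  by_cases hdet : LinearMap.det L = 0
  · simp [hdet]
  have hvol (M : V →ₗ[ℝ] V) (c : V) : volume ((fun b => c + M b) '' Metric.closedBall (0 : V) 1) =
      ENNReal.ofReal |LinearMap.det M| * volume (Metric.closedBall (0 : V) 1) := by
    rw [← Measure.addHaar_image_linearMap, ← Set.image_image (fun x => c + x) M,
      Set.image_add_left, measure_preimage_add]
  let g : V ≃ᵃ[ℝ] V := ((LinearEquiv.ofIsUnitDet (v := Module.finBasis ℝ V)
    (v' := Module.finBasis ℝ V) (f := L)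
    (by rw [LinearMap.det_toMatrix]; exact (Ne.isUnit hdet))).trans f.linear).toAffineEquiv.trans
    (AffineEquiv.constVAdd ℝ V m)
  have hg : ⇑g = fun b => m + (f.linear.toLinearMap ∘ₗ L) b := rfl
  have hf : ⇑f = fun b => f 0 + f.linear.toLinearMap b := by
    ext b
    have := f.map_vadd 0 b
    simpa [add_comm] using this
  have h := hmax _ ⟨g, rfl⟩ (by
    rintro _ ⟨b, hb, rfl⟩
    exact hL b (by simpa using hb))
  rw [hg, hf, hvol, hvol, LinearMap.det_comp, abs_mul,
    ENNReal.mul_le_mul_iff_left (Metric.measure_closedBall_pos volume _ one_pos).ne'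
      measure_closedBall_lt_top.ne, ENNReal.ofReal_le_ofReal_iff (abs_nonneg _)] at h
  have hpos : 0 < |LinearMap.det f.linear.toLinearMap| :=
    abs_pos.2 (LinearEquiv.isUnit_det' f.linear).ne_zero
  nlinarith

end

/-- Let `V` be a finite-dimensional real inner product space and `K` a compact
topological group acting continuously, irreducibly, and orthogonally on `V`.  Let
`x₀ ∈ V`, `x₀ ≠ 0`, and `C = Conv(K·x₀)`.  If `E ⊆ C` is an ellipsoid whose Lebesgue
volume is maximal among all ellipsoids contained in `C`, then `E` is a closed metric ball
centered at `0`. -/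
theorem stmt11 {V : Type*} [NormedAddCommGroup V] [InnerProductSpace ℝ V]
    [FiniteDimensional ℝ V] [MeasurableSpace V] [BorelSpace V]
    {K : Type*} [Group K] [TopologicalSpace K] [CompactSpace K]
    [MulAction K V] [ContinuousSMul K V]
    (hlin : ∀ k : K, IsLinearMap ℝ (fun v : V => k • v))
    (hiso : ∀ (k : K) (v : V), ‖k • v‖ = ‖v‖)
    (hirr : ∀ W : Submodule ℝ V, (∀ (k : K), ∀ w ∈ W, k • w ∈ W) → W = ⊥ ∨ W = ⊤)
    (x₀ : V) (hx₀ : x₀ ≠ 0)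
    (E : Set V) (hE : IsEllipsoid E)
    (hEC : E ⊆ convexHull ℝ (MulAction.orbit K x₀))
    (hmax : ∀ E' : Set V, IsEllipsoid E' → E' ⊆ convexHull ℝ (MulAction.orbit K x₀) →
      volume E' ≤ volume E) :
    ∃ r : ℝ, E = Metric.closedBall (0 : V) r := by
  have : Nontrivial V := ⟨x₀, 0, hx₀⟩
  obtain ⟨f, rfl⟩ := hE
  set C := convexHull ℝ (MulAction.orbit K x₀) with hC
  set A := f.linear with hA
  set c := f 0 with hc
  have hf (b : V) : f b = c + A b := by
    have := f.map_vadd 0 b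
    simpa [add_comm] using this
  have hCinv (k : K) {x : V} (hx : x ∈ C) : k • x ∈ C := by
    have h : (hlin k).mk' '' C ⊆ C := by
      rw [hC, LinearMap.image_convexHull]
      refine convexHull_mono ?_
      rintro _ ⟨y, hy, rfl⟩
      exact MulAction.mem_orbit_of_mem_orbit k hy
    exact h ⟨x, hx, rfl⟩
  have hmemC {b : V} (hb : ‖b‖ ≤ 1) : c + A b ∈ C := by
    rw [← hf]
    exact hEC ⟨b, by simpa using hb, rfl⟩
  have hCconv : Convex ℝ C := convex_convexHull ℝ _
  have hdet := abs_det_le_one_of_volume_maximal f hmax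
  -- all the ellipsoids `k • E` are translates of each other
  have hinv (k : K) (x : V) : ‖A.symm (k • A x)‖ = ‖x‖ := by
    let Q : V →ₗ[ℝ] V := A.symm.toLinearMap ∘ₗ (hlin k).mk' ∘ₗ A.toLinearMap
    have hQ : |LinearMap.det Q| = 1 := by
      have h : LinearMap.det Q = LinearMap.det (hlin k).mk' := LinearMap.det_conj _ A.symm
      have hn := ((⟨(hlin k).mk', hiso k⟩ : V →ₗᵢ[ℝ] V)).normDet_eq_one
      rw [h, ← Real.norm_eq_abs, ← LinearMap.normDet_eq_norm_det]
      exact hn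
    refine (norm_map_or_exists_one_lt_abs_det_midpoint Q hQ).resolve_right ?_ x
    rintro ⟨P, hP, hlt⟩
    refine hlt.not_ge (hdet _ ((1 / 2 : ℝ) • (c + k⁻¹ • c)) fun b hb => ?_)
    have h := hCconv (hmemC hb) (hCinv k⁻¹ (hmemC (b := Q (P b)) (by rwa [hP])))
      (by norm_num : (0 : ℝ) ≤ 1 / 2) (by norm_num : (0 : ℝ) ≤ 1 / 2) (by norm_num)
    have hAQ : A (Q (P b)) = k • A (P b) := A.apply_symm_apply _
    rw [hAQ, (hlin k⁻¹).map_add, inv_smul_smul] at h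
    convert h using 1
    simp only [LinearMap.smul_apply, LinearMap.add_apply, LinearMap.id_apply, map_smul, map_add]
    generalize k⁻¹ • c = c'
    module
  have hfix (k : K) : k • c = c := by
    by_contra hne
    set w := A.symm ((1 / 2 : ℝ) • (k • c - c)) with hw
    have hAw : A w = (1 / 2 : ℝ) • (k • c - c) := A.apply_symm_apply _
    have hw0 : 0 < ‖w‖ := norm_pos_iff.2 fun h => by
      rw [h, map_zero] at hAw
      exact hne (sub_eq_zero.1 ((smul_eq_zero.1 hAw.symm).resolve_left (by norm_num)))
    have hmemk {b : V} (hb : ‖b‖ ≤ 1) : k • c + A b ∈ C := by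
      have h := hCinv k (hmemC (b := A.symm (k⁻¹ • A b)) (by rwa [hinv]))
      rwa [LinearEquiv.apply_symm_apply, (hlin k).map_add, smul_inv_smul] at h
    have h := hdet (LinearMap.transvection (‖w‖⁻¹ • innerₛₗ ℝ w) w)
      ((1 / 2 : ℝ) • (c + k • c)) fun b hb => ?_
    · rw [LinearMap.transvection.det] at h
      simp only [LinearMap.smul_apply, innerₛₗ_apply_apply, real_inner_self_eq_norm_sq,
        smul_eq_mul] at h
      have h2 : ‖w‖⁻¹ * ‖w‖ ^ 2 = ‖w‖ := by field_simp
      rw [h2, abs_of_pos (by positivity)] at h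
      linarith
    · set s := ‖w‖⁻¹ * ⟪w, b⟫_ℝ with hs
      have hs1 : |s| ≤ 1 := by
        rw [hs, abs_mul, abs_inv, abs_norm, inv_mul_le_iff₀ hw0]
        exact (abs_real_inner_le_norm w b).trans (by gcongr)
      have h := hCconv (hmemC hb) (hmemk hb)
        (by linarith [le_abs_self s] : (0 : ℝ) ≤ (1 - s) / 2)
        (by linarith [neg_abs_le s] : (0 : ℝ) ≤ (1 + s) / 2) (by ring)
      convert h using 1
      rw [LinearMap.transvection.apply, map_add, map_smul, ← hA, hAw]
      simp only [LinearMap.smul_apply, innerₛₗ_apply_apply, smul_eq_mul, ← hs]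
      generalize k • c = c'
      module
  have hc0 : c = 0 := by
    have hspan := hirr (ℝ ∙ c) fun k w hw => by
      obtain ⟨t, rfl⟩ := Submodule.mem_span_singleton.1 hw
      rw [(hlin k).map_smul, hfix]
      exact hw
    refine hspan.elim Submodule.span_singleton_eq_bot.1 fun htop => ?_
    have htriv (k : K) (x : V) : k • x = x := by
      obtain ⟨t, rfl⟩ := Submodule.mem_span_singleton.1
        (htop ▸ Submodule.mem_top : x ∈ (ℝ ∙ c : Submodule ℝ V))
      rw [(hlin k).map_smul, hfix]
    have hsub : C ⊆ {x₀} := convexHull_min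
      (by rintro _ ⟨k, rfl⟩; exact htriv k x₀) (convex_singleton x₀)
    obtain ⟨b, hb⟩ := exists_norm_eq V zero_le_one
    have h1 := hsub (hmemC hb.le)
    have h0 := hsub (hmemC (b := 0) (by simp))
    rw [Set.mem_singleton_iff] at h0 h1
    have hb0 : b = 0 := A.injective (add_left_cancel (h1.trans h0.symm))
    simp [hb0] at hb
  obtain ⟨a, ha⟩ := exists_norm_sq_eq_mul_norm_sq_of_invariant hlin hiso hirr
    A.symm.toLinearMap fun k x => by simpa using hinv k (A.symm x)
  have hapos : 0 < a := by
    have h := ha x₀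
    have h1 : 0 < ‖A.symm.toLinearMap x₀‖ := norm_pos_iff.2 (by simpa using hx₀)
    have h2 : 0 < ‖x₀‖ := norm_pos_iff.2 hx₀
    exact pos_of_mul_pos_left (h ▸ pow_pos h1 2) (by positivity)
  refine ⟨√(a⁻¹), Set.ext fun x => ?_⟩
  have hx : x ∈ f '' Metric.closedBall 0 1 ↔ ‖A.symm.toLinearMap x‖ ≤ 1 := by
    constructor
    · rintro ⟨b, hb, rfl⟩
      simpa [hf, hc0] using hb
    · intro h
      exact ⟨A.symm x, by simpa using h, by simp [hf, hc0]⟩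
  rw [hx, mem_closedBall_zero_iff, Real.le_sqrt (norm_nonneg _) (inv_nonneg.2 hapos.le),
    ← sq_le_one_iff₀ (norm_nonneg _), ha, inv_eq_one_div, le_div_iff₀ hapos, mul_comm]
end

section
/- Let H₁ = H₂ = ℂ² with orthonormal bases (e₁,e₂) of H₁ and (f₁,f₂) of H₂, let 0 ≤ λ ≤ 1, set φ(λ) = λ·e₁⊗f₁ + √(1−λ²)·e₂⊗f₂ ∈ H₁⊗H₂, and let C(λ) = Conv(K·P_{φ(λ)}) be the convex hull of the orbit of P_{φ(λ)} under the local unitary group K = U(H₁)×U(H₂). If R ≥ 0 is such that every Hermitian operator of the form 𝕀_H + A with tr(A) = 0 and Hilbert–Schmidt norm ‖A‖ ≤ R belongs to C(λ), then R ≤ min{|λ² − 1/2|, 1/√12}. In particular, the radius R(λ) of the largest ball centered at 𝕀_H contained in C(λ) tends to 0 as λ² → 1/2. -/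
open Matrix
open scoped Kronecker

noncomputable section

/-- The pure state (rank-one projection) `|ψ⟩⟨ψ|` associated with a vector `ψ`. -/
def pureState {n : Type*} [Fintype n] (ψ : n → ℂ) : Matrix n n ℂ :=
  Matrix.vecMulVec ψ (star ψ)

/-- A family of vectors is an orthonormal system. -/
def ONFamily {ι n : Type*} [DecidableEq ι] [Fintype n] (v : ι → n → ℂ) : Prop :=
  ∀ i j, (∑ p, (starRingEnd ℂ) (v i p) * v j p) = if i = j then 1 else 0

/-- The Hilbert–Schmidt norm `‖A‖ = √tr(A²)` (of a Hermitian matrix `A`). -/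
def hsNorm {n : Type*} [Fintype n] (A : Matrix n n ℂ) : ℝ :=
  Real.sqrt ((A * A).trace.re)

/-- The orbit of an operator `A` on `H₁ ⊗ H₂` under the local unitary group
`K = U(H₁) × U(H₂)` acting by `(U₁,U₂)·A = (U₁ ⊗ U₂) A (U₁ ⊗ U₂)†`. -/
def localOrbit (d₁ d₂ : ℕ) (A : Matrix (Fin d₁ × Fin d₂) (Fin d₁ × Fin d₂) ℂ) :
    Set (Matrix (Fin d₁ × Fin d₂) (Fin d₁ × Fin d₂) ℂ) :=
  {B | ∃ U₁ ∈ Matrix.unitaryGroup (Fin d₁) ℂ, ∃ U₂ ∈ Matrix.unitaryGroup (Fin d₂) ℂ,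
    B = (U₁ ⊗ₖ U₂) * A * (U₁ ⊗ₖ U₂)ᴴ}

/-- The two-qubit vector `φ(λ) = λ·e₁⊗f₁ + √(1−λ²)·e₂⊗f₂`. -/
def phiVec (e f : Fin 2 → Fin 2 → ℂ) (lam : ℝ) : Fin 2 × Fin 2 → ℂ :=
  fun p => (lam : ℂ) * e 0 p.1 * f 0 p.2 +
    ((Real.sqrt (1 - lam ^ 2) : ℝ) : ℂ) * e 1 p.1 * f 1 p.2

/-- Conjugating a pure state by `M` gives the pure state of the image vector. -/
lemma mul_pureState_mul_conjTranspose {n : Type*} [Fintype n] (M : Matrix n n ℂ) (ψ : n → ℂ) :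
    M * pureState ψ * Mᴴ = pureState (M *ᵥ ψ) := by
  rw [pureState, pureState, Matrix.mul_vecMulVec, Matrix.vecMulVec_mul, Matrix.star_mulVec]

lemma kronecker_mulVec_phiVec (U V : Matrix (Fin 2) (Fin 2) ℂ) (e f : Fin 2 → Fin 2 → ℂ)
    (lam : ℝ) :
    (U ⊗ₖ V) *ᵥ phiVec e f lam = phiVec (fun i => U *ᵥ e i) (fun i => V *ᵥ f i) lam := by
  ext ⟨a, b⟩
  simp only [Matrix.mulVec, dotProduct, phiVec, Matrix.kroneckerMap_apply,
    Fintype.sum_prod_type, Fin.sum_univ_two]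
  ring

lemma onFamily_iff_star_dotProduct {ι n : Type*} [DecidableEq ι] [Fintype n] {v : ι → n → ℂ} :
    ONFamily v ↔ ∀ i j, star (v i) ⬝ᵥ v j = if i = j then 1 else 0 :=
  Iff.rfl

lemma ONFamily.mulVec {ι n : Type*} [DecidableEq ι] [Fintype n] [DecidableEq n] {v : ι → n → ℂ}
    (hv : ONFamily v) {U : Matrix n n ℂ} (hU : U ∈ Matrix.unitaryGroup n ℂ) :
    ONFamily (fun i => U *ᵥ v i) := by
  rw [onFamily_iff_star_dotProduct] at hv ⊢
  intro i j
  rw [Matrix.star_mulVec, Matrix.dotProduct_mulVec, Matrix.vecMul_vecMul,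
    ← Matrix.star_eq_conjTranspose, Matrix.mem_unitaryGroup_iff'.mp hU, Matrix.vecMul_one]
  exact hv i j

/-- Every element of the local orbit of `P_{φ(λ)}` is of the form `P_{φ(λ)}` for other
orthonormal bases. -/
lemma exists_onFamily_of_mem_localOrbit {e f : Fin 2 → Fin 2 → ℂ} (he : ONFamily e)
    (hf : ONFamily f) {lam : ℝ} {B : Matrix (Fin 2 × Fin 2) (Fin 2 × Fin 2) ℂ}
    (hB : B ∈ localOrbit 2 2 (pureState (phiVec e f lam))) :
    ∃ e' f', ONFamily e' ∧ ONFamily f' ∧ B = pureState (phiVec e' f' lam) := by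
  obtain ⟨U, hU, V, hV, rfl⟩ := hB
  exact ⟨_, _, he.mulVec hU, hf.mulVec hV, by
    rw [mul_pureState_mul_conjTranspose, kronecker_mulVec_phiVec]⟩

/-- The completeness relation for an orthonormal basis of `ℂ²`. -/
lemma ONFamily.sum_normSq {e : Fin 2 → Fin 2 → ℂ} (he : ONFamily e) (p : Fin 2) :
    Complex.normSq (e 0 p) + Complex.normSq (e 1 p) = 1 := by
  have h : (Matrix.of e)ᵀᴴ * (Matrix.of e)ᵀ = 1 := by
    ext i j
    rw [Matrix.one_apply, ← he i j]
    rfl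
  have h₂ : (Matrix.of e)ᵀ * (Matrix.of e)ᵀᴴ = 1 := _root_.mul_eq_one_comm.mp h
  have h' := congrFun (congrFun h₂ p) p
  simp only [Matrix.mul_apply, Fin.sum_univ_two, Matrix.transpose_apply, Matrix.of_apply,
    Matrix.conjTranspose_apply, Matrix.one_apply_eq, RCLike.star_def, Complex.mul_conj] at h'
  exact_mod_cast h'

lemma pureState_apply_self {n : Type*} [Fintype n] (ψ : n → ℂ) (p : n) :
    pureState ψ p p = Complex.normSq (ψ p) :=
  Complex.mul_conj _

/-- The difference of the diagonal entries of the reduced state on the first factor, which is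
the expectation of `σ_z ⊗ 1`. -/
def localPolarization (B : Matrix (Fin 2 × Fin 2) (Fin 2 × Fin 2) ℂ) : ℝ :=
  (B (0, 0) (0, 0)).re + (B (0, 1) (0, 1)).re - (B (1, 0) (1, 0)).re - (B (1, 1) (1, 1)).re

/-- The diagonal of the reduced state of `φ(λ)` on the first factor. -/
lemma sum_normSq_phiVec {e f : Fin 2 → Fin 2 → ℂ} (hf : ONFamily f) {lam : ℝ}
    (hlam : lam ^ 2 ≤ 1) (a : Fin 2) :
    Complex.normSq (phiVec e f lam (a, 0)) + Complex.normSq (phiVec e f lam (a, 1)) =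
      lam ^ 2 * Complex.normSq (e 0 a) + (1 - lam ^ 2) * Complex.normSq (e 1 a) := by
  have h00 := hf 0 0
  have h01 := hf 0 1
  have h10 := hf 1 0
  have h11 := hf 1 1
  simp only [Fin.sum_univ_two, if_true, zero_ne_one, one_ne_zero, if_false] at h00 h01 h10 h11
  have hs : ((Real.sqrt (1 - lam ^ 2) : ℝ) : ℂ) ^ 2 = 1 - (lam : ℂ) ^ 2 := by
    exact_mod_cast Real.sq_sqrt (sub_nonneg.mpr hlam)
  rw [← Complex.ofReal_inj]
  push_cast
  simp only [← Complex.mul_conj, phiVec, map_add, map_mul, Complex.conj_ofReal]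
  set s : ℂ := ((Real.sqrt (1 - lam ^ 2) : ℝ) : ℂ)
  linear_combination (lam : ℂ) ^ 2 * e 0 a * (starRingEnd ℂ) (e 0 a) * h00 +
    s ^ 2 * e 1 a * (starRingEnd ℂ) (e 1 a) * h11 +
    lam * s * e 1 a * (starRingEnd ℂ) (e 0 a) * h01 +
    lam * s * e 0 a * (starRingEnd ℂ) (e 1 a) * h10 +
    e 1 a * (starRingEnd ℂ) (e 1 a) * hs

lemma localPolarization_pureState_phiVec_le {e f : Fin 2 → Fin 2 → ℂ} (he : ONFamily e)
    (hf : ONFamily f) {lam : ℝ} (hlam : lam ^ 2 ≤ 1) :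
    localPolarization (pureState (phiVec e f lam)) ≤ 2 * |lam ^ 2 - 1 / 2| := by
  simp only [localPolarization, pureState_apply_self, Complex.ofReal_re]
  have h0 := sum_normSq_phiVec (e := e) hf hlam 0
  have h1 := sum_normSq_phiVec (e := e) hf hlam 1
  have hc0 := he.sum_normSq 0
  have hc1 := he.sum_normSq 1
  have hn : Complex.normSq (e 0 0) + Complex.normSq (e 0 1) = 1 := by
    have h := he 0 0
    simp only [Fin.sum_univ_two, if_true, ← Complex.normSq_eq_conj_mul_self] at h
    exact_mod_cast h
  have p0 := Complex.normSq_nonneg (e 0 0)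
  have p1 := Complex.normSq_nonneg (e 0 1)
  set x := Complex.normSq (e 0 0)
  set y := Complex.normSq (e 0 1)
  have hz : |x - y| ≤ 1 := abs_le.mpr ⟨by linarith, by linarith⟩
  calc _ = 2 * ((lam ^ 2 - 1 / 2) * (x - y)) := by
        linear_combination h0 - h1 + (1 - lam ^ 2) * (hc0 - hc1)
    _ ≤ 2 * |(lam ^ 2 - 1 / 2) * (x - y)| := by gcongr; exact le_abs_self _
    _ ≤ 2 * |lam ^ 2 - 1 / 2| := by
        rw [abs_mul]
        gcongr
        exact mul_le_of_le_one_right (abs_nonneg _) hz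

/-- Polarization and the first diagonal entry are controlled on the whole convex hull. -/
lemma bounds_of_mem_convexHull {e f : Fin 2 → Fin 2 → ℂ} (he : ONFamily e)
    (hf : ONFamily f) {lam : ℝ} (hlam : lam ^ 2 ≤ 1)
    {B : Matrix (Fin 2 × Fin 2) (Fin 2 × Fin 2) ℂ}
    (hB : B ∈ convexHull ℝ (localOrbit 2 2 (pureState (phiVec e f lam)))) :
    0 ≤ (B (0, 0) (0, 0)).re ∧ localPolarization B ≤ 2 * |lam ^ 2 - 1 / 2| := by
  refine convexHull_min (t := {B | 0 ≤ (B (0, 0) (0, 0)).re ∧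
    localPolarization B ≤ 2 * |lam ^ 2 - 1 / 2|}) ?_ ?_ hB
  · intro B hB
    obtain ⟨e', f', he', hf', rfl⟩ := exists_onFamily_of_mem_localOrbit he hf hB
    refine ⟨?_, localPolarization_pureState_phiVec_le he' hf' hlam⟩
    rw [pureState_apply_self]
    exact Complex.normSq_nonneg _
  · rintro X ⟨hX, hX'⟩ Y ⟨hY, hY'⟩ a b ha hb hab
    constructor
    · simp only [Matrix.add_apply, Matrix.smul_apply, Complex.add_re, Complex.smul_re, smul_eq_mul]
      positivity
    · have h : localPolarization (a • X + b • Y) =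
          a * localPolarization X + b * localPolarization Y := by
        simp only [localPolarization, Matrix.add_apply, Matrix.smul_apply, Complex.add_re,
          Complex.smul_re, smul_eq_mul]
        ring
      rw [h]
      calc _ ≤ a * (2 * |lam ^ 2 - 1 / 2|) + b * (2 * |lam ^ 2 - 1 / 2|) := by gcongr
        _ = 2 * |lam ^ 2 - 1 / 2| := by rw [← add_mul, hab, one_mul]

/-- The Hilbert–Schmidt norm of a real diagonal matrix. -/
lemma hsNorm_diagonal {n : Type*} [Fintype n] [DecidableEq n] (d : n → ℝ) :
    hsNorm (Matrix.diagonal fun p => (d p : ℂ)) = Real.sqrt (∑ p, d p ^ 2) := by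
  rw [hsNorm, Matrix.diagonal_mul_diagonal, Matrix.trace_diagonal, Complex.re_sum]
  simp [pow_two]

lemma isHermitian_diagonal_ofReal {n : Type*} [DecidableEq n] (d : n → ℝ) :
    (Matrix.diagonal fun p => (d p : ℂ)).IsHermitian :=
  Matrix.isHermitian_diagonal_of_self_adjoint _ (funext fun p => Complex.conj_ofReal (d p))

/-- for a two-qubit system, orthonormal bases `(e₁,e₂)`, `(f₁,f₂)`,
`0 ≤ λ ≤ 1` and `φ(λ) = λ·e₁⊗f₁ + √(1−λ²)·e₂⊗f₂`: if every traceless Hermitian `A` with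
Hilbert–Schmidt norm `‖A‖ ≤ R` satisfies `𝕀_H + A ∈ C(λ) = Conv(K·P_{φ(λ)})`, then
`R ≤ min {|λ² − 1/2|, 1/√12}`. -/
theorem stmt12 (e f : Fin 2 → Fin 2 → ℂ) (he : ONFamily e) (hf : ONFamily f)
    (lam : ℝ) (hlam0 : 0 ≤ lam) (hlam1 : lam ≤ 1) (R : ℝ) (hR : 0 ≤ R)
    (hball : ∀ A : Matrix (Fin 2 × Fin 2) (Fin 2 × Fin 2) ℂ,
      A.IsHermitian → A.trace = 0 → hsNorm A ≤ R →
      (4 : ℂ)⁻¹ • 1 + A ∈ convexHull ℝ (localOrbit 2 2 (pureState (phiVec e f lam)))) :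
    R ≤ min |lam ^ 2 - 1 / 2| (Real.sqrt 12)⁻¹ := by
  have hlam : lam ^ 2 ≤ 1 := pow_le_one₀ hlam0 hlam1
  have key : ∀ d : Fin 2 × Fin 2 → ℝ, ∑ p, d p = 0 → ∑ p, d p ^ 2 = R ^ 2 →
      0 ≤ 1 / 4 + d (0, 0) ∧
        d (0, 0) + d (0, 1) - d (1, 0) - d (1, 1) ≤ 2 * |lam ^ 2 - 1 / 2| := by
    intro d hd hn
    have h := bounds_of_mem_convexHull he hf hlam
      (hball (Matrix.diagonal fun p => (d p : ℂ)) (isHermitian_diagonal_ofReal d)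
        (by rw [Matrix.trace_diagonal]; exact_mod_cast hd)
        (by rw [hsNorm_diagonal, hn, Real.sqrt_sq hR]))
    have happ : ∀ p, (((4 : ℂ)⁻¹ • (1 : Matrix (Fin 2 × Fin 2) (Fin 2 × Fin 2) ℂ) +
        Matrix.diagonal fun p => (d p : ℂ)) p p).re = 1 / 4 + d p := by
      intro p
      simp [Matrix.add_apply]
    simp only [localPolarization, happ] at h
    exact ⟨h.1, by linarith [h.2]⟩
  apply le_min
  · have h := (key (fun p => if p.1 = 0 then R / 2 else -(R / 2))
      (by simp [Fintype.sum_prod_type]; ring) (by simp; ring)).2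
    norm_num at h
    linarith
  · have h3 : Real.sqrt 12 ^ 2 = 12 := Real.sq_sqrt (by norm_num)
    have hpos : 0 < Real.sqrt 12 := by positivity
    have h := (key (fun p => if p = (0, 0) then -(Real.sqrt 12 * R / 4) else Real.sqrt 12 * R / 12)
      (by simp [Fintype.sum_prod_type]; ring)
      (by simp [Fintype.sum_prod_type]; linear_combination R ^ 2 / 12 * h3)).1
    rw [if_pos rfl] at h
    rw [← one_div, le_div_iff₀ hpos]
    linarith

end
end

section
/- Let H₁ = H₂ = ℂ² with orthonormal bases (e₁,e₂) of H₁ and (f₁,f₂) of H₂, and set ρ₀ = (1/2)(P_{e₁}⊗P_{f₁} + P_{e₂}⊗P_{f₂}). Then the convex hull C₀ = Conv(K·ρ₀) of the orbit of ρ₀ under the local unitary group K = U(H₁)×U(H₂) is a convex body in the affine space 𝕀_H + su*(H₁)⊗su*(H₂) (i.e., has nonempty interior there), and C₀ ⊆ C(λ) = Conv(K·P_{φ(λ)}) for every λ with −1 ≤ λ ≤ 1, where φ(λ) = λ·e₁⊗f₁ + √(1−λ²)·e₂⊗f₂. -/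
open Matrix
open scoped Kronecker

noncomputable section

/-- The state `ρ₀ = ½ (P_{e₁}⊗P_{f₁} + P_{e₂}⊗P_{f₂})`. -/
def rho0 (e f : Fin 2 → Fin 2 → ℂ) : Matrix (Fin 2 × Fin 2) (Fin 2 × Fin 2) ℂ :=
  (2 : ℂ)⁻¹ • (pureState (e 0) ⊗ₖ pureState (f 0) + pureState (e 1) ⊗ₖ pureState (f 1))

/-- The set of traceless Hermitian matrices (`su*(H)`). -/
def suSet (n : Type*) [Fintype n] [DecidableEq n] : Set (Matrix n n ℂ) :=
  {A | A.IsHermitian ∧ A.trace = 0}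

/-- The real subspace `su*(H₁) ⊗ su*(H₂)` of Hermitian operators on `H₁ ⊗ H₂`. -/
def suKronSu (d₁ d₂ : ℕ) : Submodule ℝ (Matrix (Fin d₁ × Fin d₂) (Fin d₁ × Fin d₂) ℂ) :=
  Submodule.span ℝ
    {M | ∃ A ∈ suSet (Fin d₁), ∃ B ∈ suSet (Fin d₂), M = A ⊗ₖ B}

/-- The affine subspace `𝕀_H + su*(H₁) ⊗ su*(H₂)`. -/
def affMax (d₁ d₂ : ℕ) : Set (Matrix (Fin d₁ × Fin d₂) (Fin d₁ × Fin d₂) ℂ) :=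
  {M | ∃ B ∈ suKronSu d₁ d₂, M = (((d₁ * d₂ : ℕ) : ℂ))⁻¹ • 1 + B}

/-- Conjugation by `U ⊗ V`, as an `ℝ`-linear map. -/
def kronConj {m n : Type*} [Fintype m] [Fintype n] (U : Matrix m m ℂ) (V : Matrix n n ℂ) :
    Matrix (m × n) (m × n) ℂ →ₗ[ℝ] Matrix (m × n) (m × n) ℂ where
  toFun B := (U ⊗ₖ V) * B * (U ⊗ₖ V)ᴴ
  map_add' A B := by rw [mul_add, add_mul]
  map_smul' c A := by simp

lemma kronConj_mul {m n : Type*} [Fintype m] [Fintype n] (U U' : Matrix m m ℂ)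
    (V V' : Matrix n n ℂ) (A : Matrix (m × n) (m × n) ℂ) :
    kronConj (U * U') (V * V') A = kronConj U V (kronConj U' V' A) := by
  simp [kronConj, Matrix.mul_kronecker_mul, Matrix.conjTranspose_mul, Matrix.mul_assoc]

lemma localOrbit_kronConj_subset {d₁ d₂ : ℕ} {U : Matrix (Fin d₁) (Fin d₁) ℂ}
    {V : Matrix (Fin d₂) (Fin d₂) ℂ} (hU : U ∈ unitaryGroup (Fin d₁) ℂ)
    (hV : V ∈ unitaryGroup (Fin d₂) ℂ) (A : Matrix (Fin d₁ × Fin d₂) (Fin d₁ × Fin d₂) ℂ) :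
    localOrbit d₁ d₂ (kronConj U V A) ⊆ localOrbit d₁ d₂ A := by
  rintro _ ⟨U₁, h₁, U₂, h₂, rfl⟩
  exact ⟨U₁ * U, mul_mem h₁ hU, U₂ * V, mul_mem h₂ hV, (kronConj_mul U₁ U U₂ V A).symm⟩

lemma localOrbit_kronConj {d₁ d₂ : ℕ} {U : Matrix (Fin d₁) (Fin d₁) ℂ}
    {V : Matrix (Fin d₂) (Fin d₂) ℂ} (hU : U ∈ unitaryGroup (Fin d₁) ℂ)
    (hV : V ∈ unitaryGroup (Fin d₂) ℂ) (A : Matrix (Fin d₁ × Fin d₂) (Fin d₁ × Fin d₂) ℂ) :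
    localOrbit d₁ d₂ (kronConj U V A) = localOrbit d₁ d₂ A := by
  refine (localOrbit_kronConj_subset hU hV A).antisymm ?_
  have h := localOrbit_kronConj_subset (Unitary.star_mem hU) (Unitary.star_mem hV)
    (kronConj U V A)
  rw [← kronConj_mul, Unitary.star_mul_self_of_mem hU, Unitary.star_mul_self_of_mem hV] at h
  simpa [kronConj] using h

/-- The convex hull of a local orbit contains the local orbit of each of its points. -/
lemma convexHull_localOrbit_subset {d₁ d₂ : ℕ}
    {A B : Matrix (Fin d₁ × Fin d₂) (Fin d₁ × Fin d₂) ℂ}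
    (h : A ∈ convexHull ℝ (localOrbit d₁ d₂ B)) :
    convexHull ℝ (localOrbit d₁ d₂ A) ⊆ convexHull ℝ (localOrbit d₁ d₂ B) := by
  refine convexHull_min ?_ (convex_convexHull ℝ _)
  rintro _ ⟨U, hU, V, hV, rfl⟩
  have h' := Set.mem_image_of_mem (kronConj U V) h
  rw [LinearMap.image_convexHull] at h'
  refine convexHull_mono ?_ h'
  rintro _ ⟨_, ⟨U', hU', V', hV', rfl⟩, rfl⟩
  exact ⟨U * U', mul_mem hU hU', V * V', mul_mem hV hV', (kronConj_mul U U' V V' B).symm⟩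

/-- The standard basis of `ℂ²`. -/
def stdVec : Fin 2 → Fin 2 → ℂ := fun i => Pi.single i 1

/-- The matrix whose columns are the given vectors. -/
def colMatrix {n : Type*} (e : n → n → ℂ) : Matrix n n ℂ := Matrix.of fun p i => e i p

lemma ONFamily.colMatrix_mem {n : Type*} [Fintype n] [DecidableEq n] {e : n → n → ℂ}
    (he : ONFamily e) : colMatrix e ∈ unitaryGroup n ℂ := by
  rw [mem_unitaryGroup_iff']
  ext i j
  simpa [Matrix.mul_apply, colMatrix, Matrix.star_apply, Matrix.one_apply] using he i j

lemma pureState_mulVec {n : Type*} [Fintype n] (U : Matrix n n ℂ) (ψ : n → ℂ) :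
    pureState (U *ᵥ ψ) = U * pureState ψ * Uᴴ := by
  rw [pureState, pureState, Matrix.star_mulVec, Matrix.mul_vecMulVec, Matrix.vecMulVec_mul]

lemma colMatrix_mulVec_stdVec (e : Fin 2 → Fin 2 → ℂ) (i : Fin 2) :
    colMatrix e *ᵥ stdVec i = e i := by
  ext p
  simp [stdVec, colMatrix]

lemma rho0_eq (e f : Fin 2 → Fin 2 → ℂ) :
    rho0 e f = kronConj (colMatrix e) (colMatrix f) (rho0 stdVec stdVec) := by
  have h : ∀ (v : Fin 2 → Fin 2 → ℂ) i, pureState (v i) =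
      colMatrix v * pureState (stdVec i) * (colMatrix v)ᴴ := fun v i => by
    rw [← pureState_mulVec, colMatrix_mulVec_stdVec]
  simp only [rho0]
  rw [h e, h e, h f, h f]
  simp [kronConj, Matrix.mul_kronecker_mul, Matrix.conjTranspose_kronecker, mul_add, add_mul]

lemma phiVec_eq (e f : Fin 2 → Fin 2 → ℂ) (lam : ℝ) :
    phiVec e f lam = (colMatrix e ⊗ₖ colMatrix f) *ᵥ phiVec stdVec stdVec lam := by
  ext ⟨p, q⟩
  simp [phiVec, Matrix.mulVec, dotProduct, Fintype.sum_prod_type, Fin.sum_univ_two, stdVec,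
    colMatrix]
  ring

/-- The Pauli matrices. -/
def pauli : Fin 3 → Matrix (Fin 2) (Fin 2) ℂ :=
  ![!![0, 1; 1, 0], !![0, -Complex.I; Complex.I, 0], !![1, 0; 0, -1]]

/-- Unitaries conjugating `pauli 2` to each of the Pauli matrices. -/
def pauliFrame : Fin 3 → Matrix (Fin 2) (Fin 2) ℂ :=
  ![(2 : ℂ)⁻¹ • !![1 + Complex.I, 1 - Complex.I; 1 + Complex.I, -(1 - Complex.I)],
    (2 : ℂ)⁻¹ • !![1 + Complex.I, 1 + Complex.I; Complex.I - 1, 1 - Complex.I], 1]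

lemma pauli_mem (i : Fin 3) : pauli i ∈ unitaryGroup (Fin 2) ℂ := by
  rw [mem_unitaryGroup_iff']
  ext a b
  fin_cases i <;> fin_cases a <;> fin_cases b <;>
    simp [pauli, Matrix.mul_apply, Fin.sum_univ_two, Matrix.star_apply]

lemma pauliFrame_mem (i : Fin 3) : pauliFrame i ∈ unitaryGroup (Fin 2) ℂ := by
  rw [mem_unitaryGroup_iff']
  ext a b
  fin_cases i <;> fin_cases a <;> fin_cases b <;>
    simp [pauliFrame, Matrix.mul_apply, Fin.sum_univ_two, Matrix.star_apply] <;>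
    ring_nf <;> norm_num [map_ofNat]

lemma pauliFrame_conj (i : Fin 3) :
    pauliFrame i * pauli 2 * (pauliFrame i)ᴴ = pauli i := by
  ext a b
  fin_cases i <;> fin_cases a <;> fin_cases b <;>
    simp [pauli, pauliFrame, Matrix.mul_apply, Fin.sum_univ_two] <;>
    ring_nf <;> norm_num [map_ofNat] <;> ring

lemma pauli_zero_conj : pauli 0 * pauli 2 * (pauli 0)ᴴ = -pauli 2 := by
  ext a b
  fin_cases a <;> fin_cases b <;> simp [pauli, Matrix.mul_apply, Fin.sum_univ_two]

lemma trace_pauli (i : Fin 3) : (pauli i).trace = 0 := by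
  fin_cases i <;> simp [pauli, Matrix.trace_fin_two]

lemma trace_pauli_mul_pauli (i j : Fin 3) :
    (pauli i * pauli j).trace = if i = j then 2 else 0 := by
  fin_cases i <;> fin_cases j <;>
    simp [pauli, Matrix.trace_fin_two] <;> norm_num

lemma exists_eq_sum_pauli {A : Matrix (Fin 2) (Fin 2) ℂ} (hA : A ∈ suSet (Fin 2)) :
    ∃ a : Fin 3 → ℝ, A = ∑ i, a i • pauli i := by
  obtain ⟨hA, ht⟩ := hA
  have h₀ := hA.apply 0 0
  have h₁ := hA.apply 0 1
  have h₂ := hA.apply 1 1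
  rw [Matrix.trace_fin_two] at ht
  simp only [Complex.ext_iff, Complex.star_def, Complex.conj_re, Complex.conj_im, Complex.add_re,
    Complex.add_im, Complex.zero_re, Complex.zero_im] at h₀ h₁ h₂ ht
  refine ⟨![(A 1 0).re, (A 1 0).im, (A 0 0).re], ?_⟩
  ext a b
  fin_cases a <;> fin_cases b <;>
    simp only [pauli, Fin.sum_univ_three, Complex.ext_iff] <;>
    constructor <;> simp <;> linarith

/-- The products `σᵢ ⊗ σⱼ` of Pauli matrices. -/
def pauliKron (p : Fin 3 × Fin 3) : Matrix (Fin 2 × Fin 2) (Fin 2 × Fin 2) ℂ :=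
  pauli p.1 ⊗ₖ pauli p.2

lemma exists_eq_sum_pauliKron {B : Matrix (Fin 2 × Fin 2) (Fin 2 × Fin 2) ℂ}
    (hB : B ∈ suKronSu 2 2) : ∃ c : Fin 3 × Fin 3 → ℝ, ∑ p, c p • pauliKron p = B := by
  rw [← Submodule.mem_span_range_iff_exists_fun]
  refine Submodule.span_le.2 ?_ hB
  rintro _ ⟨X, hX, Y, hY, rfl⟩
  obtain ⟨a, rfl⟩ := exists_eq_sum_pauli hX
  obtain ⟨b, rfl⟩ := exists_eq_sum_pauli hY
  rw [SetLike.mem_coe, Submodule.mem_span_range_iff_exists_fun]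
  refine ⟨fun p => a p.1 * b p.2, ?_⟩
  ext ⟨i, k⟩ ⟨j, l⟩
  simp only [Fintype.sum_prod_type, Matrix.sum_apply, Matrix.smul_apply, pauliKron,
    Matrix.kroneckerMap_apply, Finset.sum_mul_sum, Complex.real_smul, Complex.ofReal_mul]
  exact Finset.sum_congr rfl fun _ _ => Finset.sum_congr rfl fun _ _ => by ring

/-- The coordinate of a matrix along `σᵢ ⊗ σⱼ`. -/
def pauliCoord (p : Fin 3 × Fin 3) (M : Matrix (Fin 2 × Fin 2) (Fin 2 × Fin 2) ℂ) : ℝ :=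
  (M * pauliKron p).trace.re / 4

lemma continuous_pauliCoord (p : Fin 3 × Fin 3) : Continuous (pauliCoord p) := by
  unfold pauliCoord
  exact (Complex.continuous_re.comp
    (continuous_id.matrix_mul continuous_const).matrix_trace).div_const 4

lemma trace_pauliKron (p : Fin 3 × Fin 3) : (pauliKron p).trace = 0 := by
  rw [pauliKron, Matrix.trace_kronecker, trace_pauli, zero_mul]

lemma pauliCoord_add_sum (c : Fin 3 × Fin 3 → ℝ) (z : ℂ) (p : Fin 3 × Fin 3) :
    pauliCoord p (z • 1 + ∑ q, c q • pauliKron q) = c p := by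
  have h : ∀ q, (pauliKron q * pauliKron p).trace = if q = p then 4 else 0 := fun q => by
    rw [pauliKron, pauliKron, ← Matrix.mul_kronecker_mul, Matrix.trace_kronecker,
      trace_pauli_mul_pauli, trace_pauli_mul_pauli]
    simp only [Prod.ext_iff]
    split_ifs <;> first | tauto | norm_num
  simp [pauliCoord, add_mul, Finset.sum_mul, Matrix.trace_sum, trace_pauliKron, h]

lemma rho0_stdVec : rho0 stdVec stdVec = (4 : ℝ)⁻¹ • (1 + pauliKron (2, 2)) := by
  ext ⟨i, k⟩ ⟨j, l⟩
  fin_cases i <;> fin_cases k <;> fin_cases j <;> fin_cases l <;>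
    simp [rho0, stdVec, pauliKron, pauli, pureState, Matrix.vecMulVec_apply] <;>
    norm_num

lemma kronConj_rho0 {U V : Matrix (Fin 2) (Fin 2) ℂ} (hU : U ∈ unitaryGroup (Fin 2) ℂ)
    (hV : V ∈ unitaryGroup (Fin 2) ℂ) : kronConj U V (rho0 stdVec stdVec) =
      (4 : ℝ)⁻¹ • (1 + (U * pauli 2 * Uᴴ) ⊗ₖ (V * pauli 2 * Vᴴ)) := by
  rw [mem_unitaryGroup_iff, Matrix.star_eq_conjTranspose] at hU hV
  have h : kronConj U V 1 = 1 := by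
    change (U ⊗ₖ V) * 1 * (U ⊗ₖ V)ᴴ = 1
    rw [mul_one, Matrix.conjTranspose_kronecker, ← Matrix.mul_kronecker_mul, hU, hV,
      Matrix.one_kronecker_one]
  rw [rho0_stdVec, map_smul, map_add, h]
  simp [kronConj, pauliKron, Matrix.mul_kronecker_mul, Matrix.conjTranspose_kronecker]

lemma add_pauliKron_mem (p : Fin 3 × Fin 3) :
    (4 : ℝ)⁻¹ • (1 + pauliKron p) ∈ localOrbit 2 2 (rho0 stdVec stdVec) := by
  refine ⟨_, pauliFrame_mem p.1, _, pauliFrame_mem p.2, ?_⟩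
  have h := kronConj_rho0 (pauliFrame_mem p.1) (pauliFrame_mem p.2)
  rw [pauliFrame_conj, pauliFrame_conj] at h
  exact h.symm

lemma sub_pauliKron_mem (p : Fin 3 × Fin 3) :
    (4 : ℝ)⁻¹ • (1 - pauliKron p) ∈ localOrbit 2 2 (rho0 stdVec stdVec) := by
  have hU := mul_mem (pauliFrame_mem p.1) (pauli_mem 0)
  refine ⟨_, hU, _, pauliFrame_mem p.2, ?_⟩
  have h := kronConj_rho0 hU (pauliFrame_mem p.2)
  have h' : pauliFrame p.1 * pauli 0 * pauli 2 * (pauliFrame p.1 * pauli 0)ᴴ = -pauli p.1 := by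
    rw [Matrix.conjTranspose_mul]
    calc _ = pauliFrame p.1 * (pauli 0 * pauli 2 * (pauli 0)ᴴ) * (pauliFrame p.1)ᴴ := by
          simp only [Matrix.mul_assoc]
      _ = _ := by simp [pauli_zero_conj, pauliFrame_conj]
  have hneg : (-pauli p.1) ⊗ₖ pauli p.2 = -pauliKron p := by
    ext
    simp [pauliKron]
  rw [h', pauliFrame_conj, hneg, ← sub_eq_add_neg] at h
  exact h.symm

lemma smul_pauliKron_mem (p : Fin 3 × Fin 3) {s : ℝ} (hs : |s| ≤ 4⁻¹) :
    (4 : ℝ)⁻¹ • 1 + s • pauliKron p ∈ convexHull ℝ (localOrbit 2 2 (rho0 stdVec stdVec)) := by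
  obtain ⟨h₁, h₂⟩ := abs_le.1 hs
  have h := convex_convexHull ℝ (localOrbit 2 2 (rho0 stdVec stdVec))
    (subset_convexHull ℝ _ (add_pauliKron_mem p)) (subset_convexHull ℝ _ (sub_pauliKron_mem p))
    (a := (1 + 4 * s) / 2) (b := (1 - 4 * s) / 2) (by linarith) (by linarith) (by ring)
  convert h using 1
  module

lemma sum_pauliKron_mem {c : Fin 3 × Fin 3 → ℝ} (hc : ∀ p, |c p| ≤ 36⁻¹) :
    (4 : ℝ)⁻¹ • 1 + ∑ p, c p • pauliKron p ∈
      convexHull ℝ (localOrbit 2 2 (rho0 stdVec stdVec)) := by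
  have h := (convex_convexHull ℝ (localOrbit 2 2 (rho0 stdVec stdVec))).sum_mem
    (t := Finset.univ) (w := fun _ : Fin 3 × Fin 3 => (9 : ℝ)⁻¹) (fun _ _ => by positivity)
    (by simp) (fun p _ => smul_pauliKron_mem p (s := 9 * c p) (by
      rw [abs_mul, abs_of_pos (by norm_num : (0 : ℝ) < 9)]
      linarith [hc p]))
  convert h using 1
  simp only [smul_add, Finset.sum_add_distrib, smul_smul, ← mul_assoc]
  norm_num [← smul_assoc]

lemma interior_convexHull_localOrbit_nonempty :
    (interior ((Subtype.val : affMax 2 2 → Matrix (Fin 2 × Fin 2) (Fin 2 × Fin 2) ℂ) ⁻¹'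
      (convexHull ℝ (localOrbit 2 2 (rho0 stdVec stdVec))))).Nonempty := by
  let W : Set (Matrix (Fin 2 × Fin 2) (Fin 2 × Fin 2) ℂ) := {M | ∀ p, |pauliCoord p M| < 36⁻¹}
  have hW : IsOpen W := by
    simp only [W, Set.ofPred_forall]
    exact isOpen_iInter_of_finite fun p =>
      isOpen_lt (continuous_pauliCoord p).abs continuous_const
  refine ⟨⟨_, 0, zero_mem _, rfl⟩, mem_interior.2 ⟨Subtype.val ⁻¹' W, ?_,
    hW.preimage continuous_subtype_val, fun p => ?_⟩⟩
  · rintro ⟨_, B, hB, rfl⟩ hM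
    obtain ⟨c, rfl⟩ := exists_eq_sum_pauliKron hB
    have h := sum_pauliKron_mem (c := c) fun p => by
      have := hM p
      rw [pauliCoord_add_sum] at this
      exact this.le
    rw [Set.mem_preimage]
    convert h using 2
    ext
    simp
  · have := pauliCoord_add_sum 0 (((2 * 2 : ℕ) : ℂ))⁻¹ p
    simp only [Pi.zero_apply, zero_smul, Finset.sum_const_zero] at this
    rw [this]
    norm_num

lemma rho0_stdVec_mem {lam : ℝ} (h₁ : -1 ≤ lam) (h₂ : lam ≤ 1) :
    rho0 stdVec stdVec ∈
      convexHull ℝ (localOrbit 2 2 (pureState (phiVec stdVec stdVec lam))) := by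
  have hs : (((Real.sqrt (1 - lam ^ 2) : ℝ) : ℂ)) ^ 2 = 1 - (lam : ℂ) ^ 2 := by
    rw [← Complex.ofReal_pow, Real.sq_sqrt (by nlinarith)]
    push_cast
    rfl
  let U : Fin 4 → Matrix (Fin 2) (Fin 2) ℂ := ![1, pauli 2, pauli 0, pauli 1]
  let V : Fin 4 → Matrix (Fin 2) (Fin 2) ℂ := ![1, 1, pauli 0, pauli 0]
  have hU : ∀ i, U i ∈ unitaryGroup (Fin 2) ℂ := by
    simp [U, Fin.forall_fin_succ, pauli_mem, one_mem]
  have hV : ∀ i, V i ∈ unitaryGroup (Fin 2) ℂ := by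
    simp [V, Fin.forall_fin_succ, pauli_mem, one_mem]
  have h := (convex_convexHull ℝ
    (localOrbit 2 2 (pureState (phiVec stdVec stdVec lam)))).sum_mem
    (t := Finset.univ) (w := fun _ : Fin 4 => (4 : ℝ)⁻¹) (fun _ _ => by positivity)
    (by simp) (fun i _ => subset_convexHull ℝ _ ⟨U i, hU i, V i, hV i, rfl⟩)
  convert h using 1
  simp only [← pureState_mulVec, Fin.sum_univ_four, U, V]
  ext ⟨i, k⟩ ⟨j, l⟩
  fin_cases i <;> fin_cases k <;> fin_cases j <;> fin_cases l <;>
    simp [rho0, stdVec, pauli, pureState, Matrix.vecMulVec_apply, Matrix.one_apply, phiVec,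
      Matrix.mulVec, dotProduct, Fintype.sum_prod_type, Fin.sum_univ_two] <;>
    ring_nf <;> simp [hs] <;> ring_nf

/-- for a two-qubit system with orthonormal bases `(e₁,e₂)`, `(f₁,f₂)` and
`ρ₀ = ½(P_{e₁}⊗P_{f₁} + P_{e₂}⊗P_{f₂})`, the convexed local orbit `C₀ = Conv(K·ρ₀)` is a
convex body in the affine space `𝕀_H + su*(H₁)⊗su*(H₂)` (nonempty interior there), and
`C₀ ⊆ C(λ) = Conv(K·P_{φ(λ)})` for every `λ ∈ [−1,1]`. -/
theorem stmt13 (e f : Fin 2 → Fin 2 → ℂ) (he : ONFamily e) (hf : ONFamily f) :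
    (interior ((Subtype.val : affMax 2 2 → Matrix (Fin 2 × Fin 2) (Fin 2 × Fin 2) ℂ) ⁻¹'
      (convexHull ℝ (localOrbit 2 2 (rho0 e f))))).Nonempty ∧
    ∀ lam : ℝ, -1 ≤ lam → lam ≤ 1 →
      convexHull ℝ (localOrbit 2 2 (rho0 e f)) ⊆
        convexHull ℝ (localOrbit 2 2 (pureState (phiVec e f lam))) := by
  have hE := he.colMatrix_mem
  have hF := hf.colMatrix_mem
  rw [rho0_eq e f, localOrbit_kronConj hE hF]
  refine ⟨interior_convexHull_localOrbit_nonempty, fun lam h₁ h₂ => ?_⟩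
  rw [phiVec_eq, pureState_mulVec]
  have h := localOrbit_kronConj hE hF (pureState (phiVec stdVec stdVec lam))
  exact (convexHull_localOrbit_subset (rho0_stdVec_mem h₁ h₂)).trans_eq (by rw [← h]; rfl)

end
end

section
/- Let H₁, H₂ be complex Hilbert spaces of finite dimensions d₁, d₂ ≥ 2 and let ψ ∈ H₁⊗H₂ be a unit vector. Then the orthogonal projection (with respect to the Hilbert–Schmidt inner product) of the pure state P_ψ onto the subspace su*(H₁)⊗su*(H₂) of Hermitian operators on H₁⊗H₂ is nonzero; equivalently, there exist traceless Hermitian operators A on H₁ and B on H₂ with tr(P_ψ·(A⊗B)) ≠ 0. -/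
open Matrix
open scoped Kronecker

noncomputable section

/-- `ψ` is a unit vector. -/
def IsUnitVec {n : Type*} [Fintype n] (ψ : n → ℂ) : Prop :=
  ∑ p, Complex.normSq (ψ p) = 1

lemma trace_pureState_mul_single_kronecker {m n : Type*} [Fintype m] [Fintype n]
    [DecidableEq m] [DecidableEq n] (ψ : m × n → ℂ) (i j : m) (k l : n) :
    (pureState ψ * (Matrix.single i j (1 : ℂ) ⊗ₖ Matrix.single k l (1 : ℂ))).trace =
      star (ψ (i, k)) * ψ (j, l) := by
  rw [Matrix.single_kronecker_single, Matrix.trace_mul_single]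
  simp [pureState, Matrix.vecMulVec_apply, mul_comm]

/-- The Pauli operators supported on two basis vectors `i ≠ j` are Hermitian and traceless. -/
lemma pauli_isHermitian_trace {m : Type*} [Fintype m] [DecidableEq m] {i j : m} (hij : i ≠ j) :
    ((Matrix.single i j (1 : ℂ) + Matrix.single j i 1).IsHermitian ∧
      (Matrix.single i j (1 : ℂ) + Matrix.single j i 1).trace = 0) ∧
    ((Complex.I • (Matrix.single i j (1 : ℂ) - Matrix.single j i 1)).IsHermitian ∧
      (Complex.I • (Matrix.single i j (1 : ℂ) - Matrix.single j i 1)).trace = 0) ∧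
    ((Matrix.single i i (1 : ℂ) - Matrix.single j j 1).IsHermitian ∧
      (Matrix.single i i (1 : ℂ) - Matrix.single j j 1).trace = 0) := by
  refine ⟨⟨?_, ?_⟩, ⟨?_, ?_⟩, ⟨?_, ?_⟩⟩
  · simp [Matrix.IsHermitian, Matrix.conjTranspose_single, add_comm]
  · simp [Matrix.trace_single_eq_of_ne _ _ _ hij, Matrix.trace_single_eq_of_ne _ _ _ hij.symm]
  · rw [Matrix.IsHermitian, Matrix.conjTranspose_smul, Matrix.conjTranspose_sub,
      Matrix.conjTranspose_single, Matrix.conjTranspose_single, ← neg_sub, smul_neg]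
    simp
  · simp [Matrix.trace_single_eq_of_ne _ _ _ hij, Matrix.trace_single_eq_of_ne _ _ _ hij.symm]
  · simp [Matrix.IsHermitian, Matrix.conjTranspose_single]
  · simp

/-- for `dim H₁ = d₁ ≥ 2`, `dim H₂ = d₂ ≥ 2` and a unit vector
`ψ ∈ H₁ ⊗ H₂`, the orthogonal (Hilbert–Schmidt) projection of `P_ψ` onto
`su*(H₁) ⊗ su*(H₂)` is nonzero; equivalently, there are traceless Hermitian operators
`A` on `H₁` and `B` on `H₂` with `tr(P_ψ · (A ⊗ B)) ≠ 0`. -/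
theorem stmt17 (d₁ d₂ : ℕ) (h1 : 2 ≤ d₁) (h2 : 2 ≤ d₂)
    (ψ : Fin d₁ × Fin d₂ → ℂ) (hψ : IsUnitVec ψ) :
    ∃ (A : Matrix (Fin d₁) (Fin d₁) ℂ) (B : Matrix (Fin d₂) (Fin d₂) ℂ),
      A.IsHermitian ∧ A.trace = 0 ∧ B.IsHermitian ∧ B.trace = 0 ∧
      (pureState ψ * (A ⊗ₖ B)).trace ≠ 0 := by
  obtain ⟨⟨i, k⟩, hne⟩ : ∃ p, ψ p ≠ 0 := by
    by_contra! h
    simp [IsUnitVec, h] at hψ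
  have : Nontrivial (Fin d₁) := Fin.nontrivial_iff_two_le.mpr h1
  have : Nontrivial (Fin d₂) := Fin.nontrivial_iff_two_le.mpr h2
  obtain ⟨j, hij⟩ := exists_ne i
  obtain ⟨l, hkl⟩ := exists_ne k
  obtain ⟨X₁, Y₁, Z₁⟩ := pauli_isHermitian_trace hij.symm
  obtain ⟨X₂, Y₂, Z₂⟩ := pauli_isHermitian_trace hkl.symm
  by_contra! h
  have hxx := h _ _ X₁.1 X₁.2 X₂.1 X₂.2
  have hxy := h _ _ X₁.1 X₁.2 Y₂.1 Y₂.2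
  have hxz := h _ _ X₁.1 X₁.2 Z₂.1 Z₂.2
  have hyx := h _ _ Y₁.1 Y₁.2 X₂.1 X₂.2
  have hyy := h _ _ Y₁.1 Y₁.2 Y₂.1 Y₂.2
  have hyz := h _ _ Y₁.1 Y₁.2 Z₂.1 Z₂.2
  have hzx := h _ _ Z₁.1 Z₁.2 X₂.1 X₂.2
  have hzy := h _ _ Z₁.1 Z₁.2 Y₂.1 Y₂.2
  have hzz := h _ _ Z₁.1 Z₁.2 Z₂.1 Z₂.2
  have sub_kron (A A' : Matrix (Fin d₁) (Fin d₁) ℂ) (B : Matrix (Fin d₂) (Fin d₂) ℂ) :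
      (A - A') ⊗ₖ B = A ⊗ₖ B - A' ⊗ₖ B := by
    ext; simp [sub_mul]
  have kron_sub (A : Matrix (Fin d₁) (Fin d₁) ℂ) (B B' : Matrix (Fin d₂) (Fin d₂) ℂ) :
      A ⊗ₖ (B - B') = A ⊗ₖ B - A ⊗ₖ B' := by
    ext; simp [mul_sub]
  simp only [sub_kron, kron_sub, Matrix.add_kronecker, Matrix.kronecker_add,
    Matrix.smul_kronecker, Matrix.kronecker_smul, mul_add, mul_sub, Matrix.mul_smul,
    Matrix.trace_add, Matrix.trace_sub, Matrix.trace_smul, smul_eq_mul,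
    trace_pureState_mul_single_kronecker] at hxx hxy hxz hyx hyy hyz hzx hzy hzz
  have hsa : star (ψ (i, k)) ≠ 0 := star_ne_zero.mpr hne
  have hI := Complex.I_mul_I
  have hd : ψ (j, l) = 0 := by
    refine (mul_eq_zero.mp ?_).resolve_left hsa
    grind
  simp only [hd, star_zero, mul_zero, zero_mul, add_zero, sub_zero, zero_sub] at *
  have hb : ψ (i, l) = 0 := by
    refine (mul_eq_zero.mp ?_).resolve_left hsa
    grind
  have hc : ψ (j, k) = 0 := by
    refine (mul_eq_zero.mp ?_).resolve_left hsa
    grind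
  simp [hb, hc, hne] at hzz

end
end
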